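/- Let V be an optimal computer and let T be a computable real with 0 < T ≤ 1. Then the series Σ_{p ∈ Dom V} 2^{−|p|/T} defining the partition function Z_V(T) converges, and the real Z_V(T) is weakly Chaitin T-random and T-compressible. -/

import Mathlib

open Filter Topology

/-- A set of finite binary strings is prefix-free if no string in it is a
proper prefix of another string in it. -/
def PrefixFree (S : Set (List Bool)) : Prop :=
  ∀ p ∈ S, ∀ q ∈ S, p <+: q → p = q

/-- A computer: a partial recursive function from finite binary strings to
finite binary strings whose domain is a nonempty prefix-free set. -/
structure Computer where
  f : List Bool →. List Bool
  partrec : Partrec f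
  dom_nonempty : f.Dom.Nonempty
  dom_prefixFree : PrefixFree f.Dom

/-- A computer `U` is optimal if for each computer `C` there is `d ∈ ℕ` such
that every `p ∈ Dom C` admits `q` with `U(q) = C(p)` and `|q| ≤ |p| + d`. -/
def Optimal (U : Computer) : Prop :=
  ∀ C : Computer, ∃ d : ℕ, ∀ p ∈ C.f.Dom,
    ∃ q : List Bool, U.f q = C.f p ∧ q.length ≤ p.length + d

/-- `H_C(s)`: the length of a shortest program for `C` printing `s`. -/
noncomputable def complexity (C : Computer) (s : List Bool) : ℕ :=
  sInf {n | ∃ p : List Bool, s ∈ C.f p ∧ p.length = n}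

/-- The `i`-th bit (for `i = 0, 1, 2, …`) of the base-two expansion of
`α - ⌊α⌋` with infinitely many zeros. -/
noncomputable def bitOf (α : ℝ) (i : ℕ) : Bool :=
  decide (⌊(α - ⌊α⌋) * 2 ^ (i + 1)⌋ % 2 = 1)

/-- `α↾n`: the first `n` bits of the base-two expansion of `α - ⌊α⌋`
with infinitely many zeros. -/
noncomputable def firstBits (α : ℝ) (n : ℕ) : List Bool :=
  (List.range n).map (bitOf α)

/-- A real `α` is computable if some total recursive `f : ℕ⁺ → ℚ` satisfies
`|α - f n| < 1/n` for all `n ≥ 1`. -/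
def ComputableReal (α : ℝ) : Prop :=
  ∃ f : ℕ → ℚ, Computable f ∧ ∀ n : ℕ, 0 < n → |α - (f n : ℝ)| < 1 / n

/-- `α` is weakly Chaitin `T`-random (w.r.t. the computer `U`). -/
def WeaklyChaitinTRandom (U : Computer) (T α : ℝ) : Prop :=
  ∃ c : ℕ, ∀ n : ℕ, 0 < n → T * n - c ≤ (complexity U (firstBits α n) : ℝ)

/-- `α` is Chaitin `T`-random (w.r.t. the computer `U`). -/
def ChaitinTRandom (U : Computer) (T α : ℝ) : Prop :=
  Tendsto (fun n : ℕ => (complexity U (firstBits α n) : ℝ) - T * n) atTop atTop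

/-- `α` is `T`-compressible (w.r.t. the computer `U`): `H(α↾n) ≤ Tn + o(n)`. -/
def TCompressible (U : Computer) (T α : ℝ) : Prop :=
  ∃ g : ℕ → ℝ, Tendsto (fun n : ℕ => g n / n) atTop (nhds 0) ∧
    ∀ n : ℕ, 0 < n → (complexity U (firstBits α n) : ℝ) ≤ T * n + g n

/-- The Boltzmann factor `2^(-|p|/T)` of a program `p`. -/
noncomputable def boltzmann (T : ℝ) (p : List Bool) : ℝ :=
  (2 : ℝ) ^ (-(p.length : ℝ) / T)

/-- Partition function `Z_C(T) = Σ_{p ∈ Dom C} 2^(-|p|/T)`. -/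
noncomputable def Zfun (C : Computer) (T : ℝ) : ℝ :=
  ∑' p : C.f.Dom, boltzmann T p.1

/-- Free energy `F_C(T) = -T log₂ Z_C(T)`. -/
noncomputable def Ffun (C : Computer) (T : ℝ) : ℝ :=
  -T * Real.logb 2 (Zfun C T)

/-- Energy `E_C(T) = Z_C(T)⁻¹ Σ_{p ∈ Dom C} |p| 2^(-|p|/T)`. -/
noncomputable def Efun (C : Computer) (T : ℝ) : ℝ :=
  (Zfun C T)⁻¹ * ∑' p : C.f.Dom, (p.1.length : ℝ) * boltzmann T p.1

/-- Statistical mechanical entropy `S_C(T) = (E_C(T) - F_C(T))/T`. -/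
noncomputable def Sfun (C : Computer) (T : ℝ) : ℝ :=
  (Efun C T - Ffun C T) / T

/-- `𝒵(V)`: the set of `T ∈ (0,1)` with `Z_V(T)` computable. -/
def setZ (V : Computer) : Set ℝ := {T | T ∈ Set.Ioo 0 1 ∧ ComputableReal (Zfun V T)}

/-- `ℱ(V)`: the set of `T ∈ (0,1)` with `F_V(T)` computable. -/
def setF (V : Computer) : Set ℝ := {T | T ∈ Set.Ioo 0 1 ∧ ComputableReal (Ffun V T)}

/-- `ℰ(V)`: the set of `T ∈ (0,1)` with `E_V(T)` computable. -/
def setE (V : Computer) : Set ℝ := {T | T ∈ Set.Ioo 0 1 ∧ ComputableReal (Efun V T)}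

/-- `𝒮(V)`: the set of `T ∈ (0,1)` with `S_V(T)` computable. -/
def setS (V : Computer) : Set ℝ := {T | T ∈ Set.Ioo 0 1 ∧ ComputableReal (Sfun V T)}

/-- `FP_w` (w.r.t. the optimal computer `U` fixing `H`): the set of `T ∈ (0,1)`
that are weakly Chaitin `T`-random and `T`-compressible. -/
def FPw (U : Computer) : Set ℝ :=
  {T | T ∈ Set.Ioo 0 1 ∧ WeaklyChaitinTRandom U T T ∧ TCompressible U T T}

/-- `FP` (w.r.t. the optimal computer `U` fixing `H`): the set of `T ∈ (0,1)`
that are Chaitin `T`-random and `T`-compressible. -/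
def FP (U : Computer) : Set ℝ :=
  {T | T ∈ Set.Ioo 0 1 ∧ ChaitinTRandom U T T ∧ TCompressible U T T}

/-- A computer is physically reasonable if its domain contains two strings of
different lengths. -/
def PhysicallyReasonable (C : Computer) : Prop :=
  ∃ p ∈ C.f.Dom, ∃ q ∈ C.f.Dom, p.length ≠ q.length

/-- A computable measure machine: `Z_C(1)` is a computable real. -/
def ComputableMeasureMachine (C : Computer) : Prop :=
  ComputableReal (Zfun C 1)

/-- `D` is the composition `C₀ ⊘ C₁ ⊘ ⋯ ⊘ C_{N-1}`: its domain consists of the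
concatenations `p₀p₁⋯p_{N-1}` with each `pᵢ ∈ Dom Cᵢ`, and on such a
concatenation it returns `C₀(p₀)`. -/
def IsComposition {N : ℕ} (C : Fin N → Computer) (hN : 0 < N) (D : Computer) : Prop :=
  (∀ l, l ∈ D.f.Dom ↔
      ∃ ps : Fin N → List Bool, (∀ i, ps i ∈ (C i).f.Dom) ∧ l = (List.ofFn ps).flatten) ∧
  (∀ ps : Fin N → List Bool, (∀ i, ps i ∈ (C i).f.Dom) →
      D.f ((List.ofFn ps).flatten) = (C ⟨0, hN⟩).f (ps ⟨0, hN⟩))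

/-- A sequence of computers is recursive if a single partial recursive function
uniformly computes all of them. -/
def RecursiveSeq (V : ℕ → Computer) : Prop :=
  ∃ F : ℕ × List Bool →. List Bool, Partrec F ∧ ∀ n p, (V n).f p = F (n, p)

theorem search_partrec {α β γ : Type} [Primcodable α] [Primcodable β] [Primcodable γ]
    (P : α → β → Bool) (hP : Computable₂ P) (out : α → β → γ) (hout : Computable₂ out) :
    ∃ F : α →. γ, Partrec F ∧ (∀ a, (F a).Dom ↔ ∃ b, P a b = true) ∧
      ∀ a y, y ∈ F a → ∃ b, P a b = true ∧ y = out a b := by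
  let h : α → ℕ → Option γ := fun a n =>
    (Encodable.decode n : Option β).bind (fun b => bif P a b then some (out a b) else none)
  have hh : Computable₂ h := by
    refine Computable.option_bind (Computable.decode.comp Computable.snd) ?_
    refine Computable.cond (hP.comp (Computable.fst.comp Computable.fst) Computable.snd) ?_ ?_
    · exact Computable.option_some.comp (hout.comp (Computable.fst.comp Computable.fst) Computable.snd)
    · exact Computable.const none
  have hs : ∀ a n y, y ∈ h a n → ∃ b, P a b = true ∧ y = out a b := by
    intro a n y hy
    simp only [h, Option.mem_def, Option.bind_eq_some_iff] at hy
    obtain ⟨b, -, hb⟩ := hy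
    cases hPb : P a b
    · simp [hPb] at hb
    · exact ⟨b, hPb, by simpa [hPb] using hb.symm⟩
  refine ⟨fun a => Nat.rfindOpt (h a), Partrec.rfindOpt hh, ?_, ?_⟩
  · intro a
    rw [Nat.rfindOpt_dom]
    constructor
    · rintro ⟨n, y, hy⟩
      obtain ⟨b, hb, -⟩ := hs a n y hy
      exact ⟨b, hb⟩
    · rintro ⟨b, hb⟩
      exact ⟨Encodable.encode b, out a b, by simp [h, hb]⟩
  · intro a y hy
    obtain ⟨n, hn⟩ := Nat.rfindOpt_spec hy
    exact hs a n y hn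

theorem search_total {α β : Type} [Primcodable α] [Primcodable β]
    (P : α → β → Bool) (hP : Computable₂ P) (H : ∀ a, ∃ b, P a b = true) :
    ∃ g : α → β, Computable g ∧ ∀ a, P a (g a) = true := by
  obtain ⟨F, hF, hd, hs⟩ := search_partrec P hP (fun _ b => b) Computable.snd
  have key : ∀ a, ∃ b, P a b = true ∧ b ∈ F a := by
    intro a
    obtain ⟨y, hy⟩ := Part.dom_iff_mem.1 ((hd a).2 (H a))
    obtain ⟨b, hb, he⟩ := hs a _ hy
    exact ⟨b, hb, he ▸ hy⟩
  choose g hg1 hg2 using key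
  exact ⟨g, hF.of_eq_tot hg2, hg1⟩

theorem primrec_pow : Primrec₂ (fun a b : ℕ => a ^ b) := by
  have : Primrec₂ (fun a b : ℕ => Nat.rec (motive := fun _ => ℕ) 1 (fun _ r => r * a) b) := by
    refine Primrec.nat_rec (f := fun _ => 1) (g := fun a q => q.2 * a) (Primrec.const 1) ?_
    exact Primrec.nat_mul.comp (Primrec.snd.comp Primrec.snd) Primrec.fst
  refine this.of_eq fun a b => ?_
  induction b with
  | zero => rfl
  | succ n ih => rw [pow_succ, ← ih]

theorem computable_listSum {α β : Type} [Primcodable α] [Primcodable β]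
    (f : α → List β) (g : α → β → ℕ) (hf : Computable f) (hg : Computable₂ g) :
    Computable (fun a => ((f a).map (g a)).sum) := by
  have h1 : Computable (fun a => Nat.rec (motive := fun _ => ℕ) 0
      (fun i r => r + (((f a)[i]?).map (g a)).getD 0) (f a).length) := by
    refine Computable.nat_rec (h := fun a q => q.2 + (((f a)[q.1]?).map (g a)).getD 0)
      (Computable.list_length.comp hf) (Computable.const 0) ?_
    refine Primrec.nat_add.to_comp.comp (Computable.snd.comp Computable.snd) ?_
    refine Computable.option_getD ?_ (Computable.const 0)
    refine Computable.option_map ?_ ?_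
    · exact Computable.list_getElem?.comp (hf.comp Computable.fst) (Computable.fst.comp Computable.snd)
    · exact hg.comp (Computable.fst.comp Computable.fst) Computable.snd
  refine h1.of_eq fun a => ?_
  have : ∀ (l : List β) (n : ℕ), n ≤ l.length → (Nat.rec (motive := fun _ => ℕ) 0
      (fun i r => r + ((l[i]?).map (g a)).getD 0) n : ℕ) = ((l.take n).map (g a)).sum := by
    intro l n hn
    induction n with
    | zero => simp
    | succ n ih =>
      have hn' : n < l.length := hn
      simp only
      rw [ih (by omega), List.take_add_one, List.getElem?_eq_getElem hn', List.map_append, List.sum_append]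
      simp
  rw [this _ _ le_rfl, List.take_length]

noncomputable def enc0 (q : ℚ) : ℕ := @Encodable.encode ℚ Rat.instEncodable q
theorem enc0_eq (q : ℚ) : enc0 q = Nat.pair (Equiv.intEquivNat q.num) q.den := rfl
theorem int_eq (z : ℤ) : Equiv.intEquivNat z = if 0 ≤ z then 2 * z.toNat else 2 * (-z-1).toNat + 1 := by
  cases z with
  | ofNat n =>
    have h : Equiv.intEquivNat (Int.ofNat n) = 2 * n := rfl
    rw [h]; simp
  | negSucc n => 
    have h : Equiv.intEquivNat (Int.negSucc n) = 2 * n + 1 := rfl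
    rw [h, if_neg (by omega)]; omega
noncomputable def enc1 (q : ℚ) : ℕ := @Encodable.encode ℚ (Primcodable.ofDenumerable ℚ).toEncodable q
open Classical in
theorem encode_rat (q : ℚ) : enc1 q = (List.range (enc0 q)).countP (fun y => y ∈ Set.range enc0) := by
  have : enc1 q = (List.range (enc0 q)).countP (fun y => @decide _ (@Encodable.decidableRangeEncode ℚ Rat.instEncodable y)) := rfl
  rw [this]
  congr 1
  funext y
  exact decide_eq_decide.2 Iff.rfl

def coprimeB (a b : ℕ) : Prop := ∀ x < a + b + 1, x < 2 ∨ a % x ≠ 0 ∨ b % x ≠ 0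

theorem coprimeB_iff (a b : ℕ) (hb : 0 < b) : coprimeB a b ↔ Nat.Coprime a b := by
  constructor
  · intro h
    by_contra hc
    have hpos : 0 < Nat.gcd a b := Nat.gcd_pos_of_pos_right _ hb
    have h2 : Nat.gcd a b ≤ b := Nat.gcd_le_right _ hb
    have h3 : Nat.gcd a b ≠ 1 := hc
    rcases h (Nat.gcd a b) (by omega) with h | h | h
    · omega
    · exact h (Nat.mod_eq_zero_of_dvd (Nat.gcd_dvd_left _ _))
    · exact h (Nat.mod_eq_zero_of_dvd (Nat.gcd_dvd_right _ _))
  · intro h x _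
    by_contra hc
    push Not at hc
    obtain ⟨h1, h2, h3⟩ := hc
    have := Nat.dvd_gcd (Nat.dvd_of_mod_eq_zero h2) (Nat.dvd_of_mod_eq_zero h3)
    rw [h] at this
    have := Nat.le_of_dvd one_pos this
    omega

theorem primrec_coprimeB : PrimrecRel coprimeB := by
  have h1 : PrimrecRel (fun (x : ℕ) (p : ℕ) => x < 2 ∨ p.unpair.1 % x ≠ 0 ∨ p.unpair.2 % x ≠ 0) := by
    refine PrimrecPred.or ?_ (PrimrecPred.or ?_ ?_)
    · exact Primrec.nat_lt.comp Primrec.fst (Primrec.const 2)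
    · exact (Primrec.eq.comp (Primrec.nat_mod.comp (Primrec.fst.comp (Primrec.unpair.comp Primrec.snd)) Primrec.fst)
        (Primrec.const 0)).not
    · exact (Primrec.eq.comp (Primrec.nat_mod.comp (Primrec.snd.comp (Primrec.unpair.comp Primrec.snd)) Primrec.fst)
        (Primrec.const 0)).not
  have h2 := PrimrecRel.forall_lt h1
  have h3 := h2.comp (Primrec.succ.comp (Primrec.nat_add.comp Primrec.fst Primrec.snd))
    (Primrec₂.natPair.comp (Primrec.fst (α := ℕ) (β := ℕ)) (Primrec.snd (α := ℕ) (β := ℕ)))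
  refine h3.of_eq fun p => ?_
  simp [coprimeB]

def goodCode (y : ℕ) : Prop :=
  0 < (Nat.unpair y).2 ∧ coprimeB (((Nat.unpair y).1 + 1) / 2) (Nat.unpair y).2

theorem natAbs_code (z : ℤ) : (Equiv.intEquivNat z + 1) / 2 = z.natAbs := by
  rw [int_eq]; split_ifs <;> omega

theorem goodCode_iff (y : ℕ) : goodCode y ↔ y ∈ Set.range enc0 := by
  constructor
  · rintro ⟨h1, h2⟩
    rw [coprimeB_iff _ _ h1] at h2
    refine ⟨⟨Equiv.intEquivNat.symm (Nat.unpair y).1, (Nat.unpair y).2, h1.ne', ?_⟩, ?_⟩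
    · rw [← natAbs_code, Equiv.apply_symm_apply]; exact h2
    · rw [enc0_eq]; simp
  · rintro ⟨q, rfl⟩
    rw [enc0_eq]
    simp only [goodCode, Nat.unpair_pair]
    exact ⟨q.den_pos, (coprimeB_iff _ _ q.den_pos).2 (by rw [natAbs_code]; exact q.reduced)⟩

theorem primrec_goodCode : PrimrecPred goodCode := by
  have h1 : Primrec (fun y => (Nat.unpair y).1) := Primrec.fst.comp Primrec.unpair
  have h2 : Primrec (fun y => (Nat.unpair y).2) := Primrec.snd.comp Primrec.unpair
  refine PrimrecPred.and (Primrec.nat_lt.comp (Primrec.const 0) h2) ?_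
  exact primrec_coprimeB.comp (Primrec.nat_div.comp (Primrec.succ.comp h1) (Primrec.const 2)) h2

theorem enc0_inj {q r : ℚ} (h : enc0 q = enc0 r) : q = r :=
  @Encodable.encode_injective ℚ Rat.instEncodable _ _ h

theorem computable_enc0 : ∃ g : ℕ → ℕ, Computable g ∧ ∀ q : ℚ, g (enc1 q) = enc0 q := by
  classical
  have hc : Primrec (fun x : ℕ => ((List.range x).filter (fun y => goodCode y)).length) :=
    Primrec.list_length.comp ((Primrec.listFilter primrec_goodCode).comp Primrec.list_range)
  have hcount : ∀ q : ℚ, enc1 q =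
      ((List.range (enc0 q)).filter (fun y => goodCode y)).length := by
    intro q
    rw [encode_rat, List.countP_eq_length_filter]
    congr 2
    funext y
    exact decide_eq_decide.2 (goodCode_iff y).symm
  obtain ⟨g, hg, hg2⟩ := search_total (α := ℕ) (β := ℕ)
    (fun n y => decide (goodCode y ∧ ((List.range y).filter (fun y => goodCode y)).length = n))
    (by
      have : PrimrecPred (fun p : ℕ × ℕ => goodCode p.2 ∧
          ((List.range p.2).filter (fun y => goodCode y)).length = p.1) :=
        (primrec_goodCode.comp Primrec.snd).and
          (Primrec.eq.comp (hc.comp Primrec.snd) Primrec.fst)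
      exact this.decide.to_comp)
    (by
      intro n
      refine ⟨enc0 (Denumerable.ofNat ℚ n), ?_⟩
      have := hcount (Denumerable.ofNat ℚ n)
      rw [enc1, Denumerable.encode_ofNat] at this
      exact decide_eq_true ⟨(goodCode_iff _).2 ⟨_, rfl⟩, this.symm⟩)
  refine ⟨g, hg, fun q => ?_⟩
  have := of_decide_eq_true (hg2 (enc1 q))
  obtain ⟨r, hr⟩ := (goodCode_iff _).1 this.1
  have h2 := this.2
  rw [← hr, ← hcount] at h2
  rw [← hr, @Encodable.encode_injective ℚ (Primcodable.ofDenumerable ℚ).toEncodable _ _ h2]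

theorem computable_rat (f : ℕ → ℚ) (hf : Computable f) :
    ∃ u v : ℕ → ℕ, Computable u ∧ Computable v ∧
      ∀ n, u n = (f n).num.toNat ∧ v n = (f n).den := by
  obtain ⟨g, hg, hg2⟩ := computable_enc0
  have h1 : Computable (fun n => Nat.unpair (g (enc1 (f n)))) :=
    Computable.unpair.comp (hg.comp (Computable.encode.comp hf))
  have hu : Primrec (fun x : ℕ => if x % 2 = 0 then x / 2 else 0) :=
    Primrec.ite (Primrec.eq.comp (Primrec.nat_mod.comp Primrec.id (Primrec.const 2))
      (Primrec.const 0)) (Primrec.nat_div.comp Primrec.id (Primrec.const 2)) (Primrec.const 0)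
  refine ⟨_, _, hu.to_comp.comp (Computable.fst.comp h1), Computable.snd.comp h1, fun n => ?_⟩
  simp only [hg2, enc0_eq, Nat.unpair_pair, and_true]
  rw [int_eq]
  split_ifs <;> omega

noncomputable def phiT (m k : ℕ) (t : ℝ) : ℝ := 2 ^ k * (2 : ℝ) ^ (-(m : ℝ) / t)

theorem phiT_mono (m k : ℕ) {s t : ℝ} (hs : 0 < s) (hst : s ≤ t) : phiT m k s ≤ phiT m k t := by
  unfold phiT
  refine mul_le_mul_of_nonneg_left ?_ (by positivity)
  refine Real.rpow_le_rpow_of_exponent_le one_le_two ?_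
  rw [neg_div, neg_div, neg_le_neg_iff]
  exact div_le_div_of_nonneg_left (by positivity) hs hst

theorem phiT_pow (m k a b : ℕ) (ha : 0 < a) (hb : 0 < b) :
    phiT m k ((a : ℝ) / b) ^ a * 2 ^ (m * b) = 2 ^ (k * a) := by
  unfold phiT
  rw [mul_pow, ← pow_mul, ← Real.rpow_natCast ((2 : ℝ) ^ _) a, ← Real.rpow_mul (by norm_num)]
  have : -(m : ℝ) / (a / b) * a = -((m * b : ℕ) : ℝ) := by
    have : (a : ℝ) ≠ 0 := by positivity
    have : (b : ℝ) ≠ 0 := by positivity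
    push_cast
    field_simp
  rw [this, Real.rpow_neg (by norm_num), Real.rpow_natCast, mul_assoc,
    inv_mul_cancel₀ (by positivity), mul_one]

theorem le_phiT_iff (m k a b A : ℕ) (ha : 0 < a) (hb : 0 < b) :
    A ^ a * 2 ^ (m * b) ≤ 2 ^ (k * a) ↔ (A : ℝ) ≤ phiT m k ((a : ℝ) / b) := by
  have h0 : 0 ≤ phiT m k ((a : ℝ) / b) := by unfold phiT; positivity
  rw [← pow_le_pow_iff_left₀ (by positivity) h0 ha.ne',
    ← mul_le_mul_iff_left₀ (show (0 : ℝ) < 2 ^ (m * b) by positivity), phiT_pow m k a b ha hb]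
  exact_mod_cast Iff.rfl

theorem phiT_le_iff (m k a b A : ℕ) (ha : 0 < a) (hb : 0 < b) :
    2 ^ (k * a) ≤ A ^ a * 2 ^ (m * b) ↔ phiT m k ((a : ℝ) / b) ≤ (A : ℝ) := by
  have h0 : 0 ≤ phiT m k ((a : ℝ) / b) := by unfold phiT; positivity
  rw [← pow_le_pow_iff_left₀ h0 (by positivity) ha.ne',
    ← mul_le_mul_iff_left₀ (show (0 : ℝ) < 2 ^ (m * b) by positivity), phiT_pow m k a b ha hb]
  exact_mod_cast Iff.rfl

def wpred (u v : ℕ) (m k A N : ℕ) : Prop :=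
  (0 < N ∧ 0 < u * N - v) ∧ (A ^ (u * N - v) * 2 ^ (m * (v * N)) ≤ 2 ^ (k * (u * N - v))
  ∧ 2 ^ (k * (u * N + v)) ≤ (A + 2) ^ (u * N + v) * 2 ^ (m * (v * N)))

theorem primrec_wpred : PrimrecPred (fun q : (ℕ × ℕ) × (ℕ × ℕ) × (ℕ × ℕ) =>
      wpred q.1.1 q.1.2 q.2.1.1 q.2.1.2 q.2.2.1 q.2.2.2) := by
    have pu : Primrec (fun q : (ℕ × ℕ) × (ℕ × ℕ) × (ℕ × ℕ) => q.1.1) := Primrec.fst.comp Primrec.fst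
    have pv : Primrec (fun q : (ℕ × ℕ) × (ℕ × ℕ) × (ℕ × ℕ) => q.1.2) := Primrec.snd.comp Primrec.fst
    have pm : Primrec (fun q : (ℕ × ℕ) × (ℕ × ℕ) × (ℕ × ℕ) => q.2.1.1) :=
      Primrec.fst.comp (Primrec.fst.comp Primrec.snd)
    have pk : Primrec (fun q : (ℕ × ℕ) × (ℕ × ℕ) × (ℕ × ℕ) => q.2.1.2) :=
      Primrec.snd.comp (Primrec.fst.comp Primrec.snd)
    have pA : Primrec (fun q : (ℕ × ℕ) × (ℕ × ℕ) × (ℕ × ℕ) => q.2.2.1) :=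
      Primrec.fst.comp (Primrec.snd.comp Primrec.snd)
    have pN : Primrec (fun q : (ℕ × ℕ) × (ℕ × ℕ) × (ℕ × ℕ) => q.2.2.2) :=
      Primrec.snd.comp (Primrec.snd.comp Primrec.snd)
    have pa := Primrec.nat_sub.comp (Primrec.nat_mul.comp pu pN) pv
    have pa' := Primrec.nat_add.comp (Primrec.nat_mul.comp pu pN) pv
    have pb := primrec_pow.comp (Primrec.const 2) (Primrec.nat_mul.comp pm (Primrec.nat_mul.comp pv pN))
    refine ((Primrec.nat_lt.comp (Primrec.const 0) pN).and
      (Primrec.nat_lt.comp (Primrec.const 0) pa)).and (PrimrecPred.and ?_ ?_)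
    · exact Primrec.nat_le.comp (Primrec.nat_mul.comp (primrec_pow.comp pA pa) pb)
        (primrec_pow.comp (Primrec.const 2) (Primrec.nat_mul.comp pk pa))
    · exact Primrec.nat_le.comp (primrec_pow.comp (Primrec.const 2) (Primrec.nat_mul.comp pk pa'))
        (Primrec.nat_mul.comp (primrec_pow.comp (Primrec.nat_add.comp pA (Primrec.const 2)) pa') pb)

theorem weights_exists (T : ℝ) (hT : 0 < T) (u v : ℕ → ℕ)
    (hv0 : ∀ n, 0 < v n) (hf : ∀ N, 0 < N → |T - (u N : ℝ) / v N| < 1 / N) (m k : ℕ) :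
    ∃ r : ℕ × ℕ, wpred (u r.2) (v r.2) m k r.1 r.2 := by
  have hcont : ContinuousAt (phiT m k) T := by
    unfold phiT
    refine ContinuousAt.mul continuousAt_const ?_
    refine ContinuousAt.rpow continuousAt_const ?_ (Or.inl (by norm_num))
    exact continuousAt_const.div continuousAt_id hT.ne'
  have hpos : 0 < phiT m k T := by unfold phiT; positivity
  obtain ⟨A, hA1, hA2⟩ : ∃ A : ℕ, (A : ℝ) < phiT m k T ∧ phiT m k T < A + 2 := by
    refine ⟨⌈phiT m k T⌉₊ - 1, ?_, ?_⟩
    · have := Nat.ceil_lt_add_one hpos.le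
      have h1 := Nat.ceil_pos.2 hpos
      rw [Nat.cast_sub h1]; push_cast; linarith
    · have := Nat.le_ceil (phiT m k T)
      have h1 := Nat.ceil_pos.2 hpos
      rw [Nat.cast_sub h1]; push_cast; linarith
  have hinv : Tendsto (fun N : ℕ => (1 : ℝ) / N) atTop (𝓝 0) := tendsto_one_div_atTop_nhds_zero_nat
  have hlim : Tendsto (fun N : ℕ => (u N : ℝ) / v N) atTop (𝓝 T) := by
    rw [tendsto_iff_dist_tendsto_zero]
    refine squeeze_zero' (Eventually.of_forall fun _ => dist_nonneg) ?_ hinv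
    filter_upwards [eventually_gt_atTop 0] with N hN
    rw [dist_comm, Real.dist_eq]
    exact (hf N hN).le
  have hl1 : Tendsto (fun N : ℕ => (u N : ℝ) / v N - 1 / N) atTop (𝓝 T) := by
    simpa using hlim.sub hinv
  have hl2 : Tendsto (fun N : ℕ => (u N : ℝ) / v N + 1 / N) atTop (𝓝 T) := by
    simpa using hlim.add hinv
  have e1 := (hcont.tendsto.comp hl1).eventually (lt_mem_nhds hA1)
  have e2 := (hcont.tendsto.comp hl2).eventually (gt_mem_nhds hA2)
  have e3 := hl1.eventually (lt_mem_nhds hT)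
  obtain ⟨N, h1, h2, h3, hN⟩ := (e1.and (e2.and (e3.and (eventually_gt_atTop 0)))).exists
  refine ⟨(A, N), ?_⟩
  have hvp : (0 : ℝ) < v N := by exact_mod_cast hv0 N
  have hNp : (0 : ℝ) < N := by exact_mod_cast hN
  have hlt : v N < u N * N := by
    have : (0 : ℝ) < ((u N : ℝ) * N - v N) / (v N * N) := by
      have e : ((u N : ℝ) * N - v N) / (v N * N) = (u N : ℝ) / v N - 1 / N := by field_simp
      rw [e]; exact h3
    rw [div_pos_iff_of_pos_right (by positivity)] at this
    have : (v N : ℝ) < u N * N := by linarith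
    exact_mod_cast this
  have hb : 0 < v N * N := Nat.mul_pos (hv0 N) hN
  have h1' : (A : ℝ) ≤ phiT m k ((u N : ℝ) / v N - 1 / N) := le_of_lt h1
  have h2' : phiT m k ((u N : ℝ) / v N + 1 / N) ≤ A + 2 := le_of_lt h2
  have e1 : ((u N * N - v N : ℕ) : ℝ) / (v N * N : ℕ) = (u N : ℝ) / v N - 1 / N := by
    rw [Nat.cast_sub hlt.le]; push_cast; field_simp
  have e2 : ((u N * N + v N : ℕ) : ℝ) / (v N * N : ℕ) = (u N : ℝ) / v N + 1 / N := by
    push_cast; field_simp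
  show wpred (u N) (v N) m k A N
  refine ⟨⟨hN, by omega⟩, ?_, ?_⟩
  · rw [le_phiT_iff _ _ _ _ _ (by omega) hb, e1]
    exact h1'
  · rw [phiT_le_iff _ _ _ _ _ (by omega) hb, e2]
    push_cast
    exact h2'

theorem weights_search (u v : ℕ → ℕ) (hu : Computable u) (hv : Computable v)
    (H : ∀ m k, ∃ r : ℕ × ℕ, wpred (u r.2) (v r.2) m k r.1 r.2) :
    ∃ g : ℕ × ℕ → ℕ × ℕ, Computable g ∧
      ∀ q, wpred (u (g q).2) (v (g q).2) q.1 q.2 (g q).1 (g q).2 := by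
  classical
  have h1 : Computable (fun z : (ℕ × ℕ) × (ℕ × ℕ) => ((u z.2.2, v z.2.2), z.1, z.2)) :=
    Computable.pair (Computable.pair
      (hu.comp (Computable.snd.comp Computable.snd)) (hv.comp (Computable.snd.comp Computable.snd)))
      (Computable.pair Computable.fst Computable.snd)
  have h2 := primrec_wpred.decide.to_comp.comp h1
  obtain ⟨g, hg, hg2⟩ := search_total (α := ℕ × ℕ) (β := ℕ × ℕ)
    (fun q r => decide (wpred (u r.2) (v r.2) q.1 q.2 r.1 r.2)) h2 (by
      rintro ⟨m, k⟩
      obtain ⟨r, hr⟩ := H m k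
      exact ⟨r, decide_eq_true hr⟩)
  exact ⟨g, hg, fun q => of_decide_eq_true (hg2 q)⟩

theorem weights (T : ℝ) (hT : 0 < T) (u v : ℕ → ℕ) (hu : Computable u) (hv : Computable v)
    (hv0 : ∀ n, 0 < v n) (hf : ∀ N, 0 < N → |T - (u N : ℝ) / v N| < 1 / N) :
    ∃ W : ℕ × ℕ → ℕ, Computable W ∧
      ∀ m k, (W (m, k) : ℝ) ≤ phiT m k T ∧ phiT m k T ≤ W (m, k) + 2 := by
  obtain ⟨g, hg, hg2⟩ := weights_search u v hu hv (weights_exists T hT u v hv0 hf)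
  refine ⟨fun q => (g q).1, Computable.fst.comp hg, fun m k => ?_⟩
  have hw := hg2 (m, k)
  show (((g (m, k)).1 : ℕ) : ℝ) ≤ _ ∧ _ ≤ (((g (m, k)).1 : ℕ) : ℝ) + 2
  generalize (g (m, k)).1 = A at hw ⊢
  generalize (g (m, k)).2 = N at hw
  obtain ⟨⟨hN, ha⟩, h1, h2⟩ := hw
  have hb : 0 < v N * N := Nat.mul_pos (hv0 N) hN
  rw [le_phiT_iff _ _ _ _ _ (by omega) hb] at h1
  rw [phiT_le_iff _ _ _ _ _ (by omega) hb] at h2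
  have hvp : (0 : ℝ) < v N := by exact_mod_cast hv0 N
  have hNp : (0 : ℝ) < N := by exact_mod_cast hN
  have hlt : v N < u N * N := by omega
  have habs := abs_lt.1 (hf N hN)
  have e1 : ((u N * N - v N : ℕ) : ℝ) / (v N * N : ℕ) = (u N : ℝ) / v N - 1 / N := by
    rw [Nat.cast_sub hlt.le]; push_cast; field_simp
  have e2 : ((u N * N + v N : ℕ) : ℝ) / (v N * N : ℕ) = (u N : ℝ) / v N + 1 / N := by
    push_cast; field_simp
  constructor
  · refine h1.trans (phiT_mono m k ?_ ?_)
    · have : (0 : ℝ) < ((u N * N - v N : ℕ) : ℝ) := by exact_mod_cast ha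
      have : (0 : ℝ) < ((v N * N : ℕ) : ℝ) := by exact_mod_cast hb
      positivity
    · rw [e1]; linarith
  · refine (phiT_mono m k hT ?_).trans (h2.trans (by push_cast; rfl))
    rw [e2]; linarith

def enumStep (c : Nat.Partrec.Code) (k x : ℕ) : Option (List Bool × List Bool) :=
  (Encodable.decode x : Option (List Bool)).bind fun p =>
    if Encodable.encode p = x then
      ((Nat.Partrec.Code.evaln k c x).bind fun y => (Encodable.decode y : Option (List Bool))).map
        fun s => (p, s)
    else none

theorem primrec_enumStep (c : Nat.Partrec.Code) : Primrec₂ (enumStep c) := by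
  unfold enumStep
  refine Primrec.option_bind (Primrec.decode.comp Primrec.snd) ?_
  refine Primrec.ite (Primrec.eq.comp (Primrec.encode.comp Primrec.snd) (Primrec.snd.comp Primrec.fst))
    ?_ (Primrec.const none)
  refine Primrec.option_map ?_ (Primrec.pair (Primrec.snd.comp Primrec.fst) Primrec.snd)
  refine Primrec.option_bind ?_ (Primrec.decode.comp Primrec.snd)
  exact Nat.Partrec.Code.primrec_evaln.comp (Primrec.pair (Primrec.pair (Primrec.fst.comp Primrec.fst)
    (Primrec.const c)) (Primrec.snd.comp Primrec.fst))

theorem mem_enumStep (c : Nat.Partrec.Code) (k x : ℕ) (p s : List Bool) :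
    (p, s) ∈ enumStep c k x ↔ Encodable.encode p = x ∧
      ∃ y, y ∈ Nat.Partrec.Code.evaln k c x ∧ Encodable.decode y = some s := by
  unfold enumStep
  simp only [Option.mem_def, Option.bind_eq_some_iff]
  constructor
  · rintro ⟨q, hq, h⟩
    split_ifs at h with hx
    simp only [Option.map_eq_some_iff, Option.bind_eq_some_iff, Prod.mk.injEq] at h
    obtain ⟨s', ⟨y, hy, hd⟩, rfl, rfl⟩ := h
    exact ⟨hx, y, hy, hd⟩
  · rintro ⟨rfl, y, hy, hd⟩
    refine ⟨p, Encodable.encodek p, ?_⟩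
    rw [if_pos rfl]
    simp only [Option.map_eq_some_iff, Option.bind_eq_some_iff, Prod.mk.injEq]
    exact ⟨s, ⟨y, hy, hd⟩, by simp⟩

theorem enumeration (V : Computer) :
    ∃ E : ℕ → List (List Bool × List Bool), Primrec E ∧
      (∀ k, ((E k).map Prod.fst).Nodup) ∧ (∀ k, ∀ x ∈ E k, x.2 ∈ V.f x.1) ∧
      (∀ k l, k ≤ l → E k ⊆ E l) ∧ ∀ p s, s ∈ V.f p → ∃ k, (p, s) ∈ E k := by
  obtain ⟨c, hc⟩ := Nat.Partrec.Code.exists_code.1 V.partrec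
  have hev : ∀ p, c.eval (Encodable.encode p) = (V.f p).map Encodable.encode := by
    intro p
    rw [hc]; simp
  have hmem : ∀ k p s, (p, s) ∈ (List.range k).filterMap (enumStep c k) ↔
      Encodable.encode s ∈ Nat.Partrec.Code.evaln k c (Encodable.encode p) := by
    intro k p s
    rw [List.mem_filterMap]
    constructor
    · rintro ⟨x, -, hx⟩
      obtain ⟨rfl, y, hy, hd⟩ := (mem_enumStep c k x p s).1 hx
      have h2 := Nat.Partrec.Code.evaln_sound hy
      rw [hev] at h2
      obtain ⟨s', -, rfl⟩ := (Part.mem_map_iff _).1 h2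
      rw [Encodable.encodek, Option.some_inj] at hd
      rw [← hd]; exact hy
    · intro h
      exact ⟨Encodable.encode p, List.mem_range.2 (Nat.Partrec.Code.evaln_bound h),
        (mem_enumStep c k _ p s).2 ⟨rfl, _, h, Encodable.encodek s⟩⟩
  refine ⟨fun k => (List.range k).filterMap (enumStep c k), ?_, ?_, ?_, ?_, ?_⟩
  · exact Primrec.listFilterMap Primrec.list_range (primrec_enumStep c)
  · intro k
    rw [List.map_filterMap]
    refine List.Nodup.filterMap ?_ List.nodup_range
    intro a a' b hb hb'
    simp only [Option.mem_def, Option.map_eq_some_iff] at hb hb'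
    obtain ⟨⟨p, s⟩, h, rfl⟩ := hb
    obtain ⟨⟨p', s'⟩, h', he⟩ := hb'
    rw [← ((mem_enumStep c k a p s).1 h).1, ← ((mem_enumStep c k a' p' s').1 h').1]
    simp only at he
    rw [he]
  · rintro k ⟨p, s⟩ h
    have h2 := Nat.Partrec.Code.evaln_sound ((hmem k p s).1 h)
    rw [hev] at h2
    obtain ⟨s', hs, he⟩ := (Part.mem_map_iff _).1 h2
    rw [← Encodable.encode_injective he]; exact hs
  · rintro k l hkl ⟨p, s⟩ h
    exact (hmem l p s).2 (Nat.Partrec.Code.evaln_mono hkl ((hmem k p s).1 h))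
  · intro p s h
    have : Encodable.encode s ∈ c.eval (Encodable.encode p) := by
      rw [hev]; exact Part.mem_map _ h
    obtain ⟨k, hk⟩ := Nat.Partrec.Code.evaln_complete.1 this
    exact ⟨k, (hmem k p s).2 hk⟩

/-! bits -/

theorem bitOf_eq (α : ℝ) (hα : 0 ≤ α) (i : ℕ) :
    bitOf α i = decide (⌊α * 2 ^ (i + 1)⌋₊ % 2 = 1) := by
  unfold bitOf
  rw [decide_eq_decide]
  have h1 : (α - ⌊α⌋) * 2 ^ (i + 1) = α * 2 ^ (i + 1) - ((2 * (⌊α⌋ * 2 ^ i) : ℤ) : ℝ) := by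
    push_cast; ring
  have h2 : (⌊α * 2 ^ (i + 1)⌋₊ : ℤ) = ⌊α * 2 ^ (i + 1)⌋ :=
    Int.natCast_floor_eq_floor (by positivity)
  rw [h1, Int.floor_sub_intCast, ← h2]
  omega

theorem floor_div (α : ℝ) (n k : ℕ) : ⌊α * 2 ^ (n + k)⌋₊ / 2 ^ k = ⌊α * 2 ^ n⌋₊ := by
  have := Nat.floor_div_natCast (α * 2 ^ (n + k)) (2 ^ k)
  rw [← this]
  congr 1
  push_cast
  rw [pow_add]
  field_simp

/-- The first `n` bits of `J / 2^n`. -/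
def bitsOf (n J : ℕ) : List Bool :=
  (List.range n).map fun i => decide (J / 2 ^ (n - (i + 1)) % 2 = 1)

theorem bitsOf_floor (α : ℝ) (hα : 0 ≤ α) (n : ℕ) : bitsOf n ⌊α * 2 ^ n⌋₊ = firstBits α n := by
  unfold bitsOf firstBits
  refine List.map_congr_left fun i hi => ?_
  rw [List.mem_range] at hi
  rw [bitOf_eq α hα]
  have := floor_div α (i + 1) (n - (i + 1))
  rw [Nat.add_sub_cancel' hi] at this
  rw [this]

theorem primrec_bitsOf : Primrec₂ bitsOf := by
  unfold bitsOf
  refine Primrec.list_map (Primrec.list_range.comp Primrec.fst) ?_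
  have hn : Primrec (fun q : (ℕ × ℕ) × ℕ => q.1.1) := Primrec.fst.comp Primrec.fst
  have hJ : Primrec (fun q : (ℕ × ℕ) × ℕ => q.1.2) := Primrec.snd.comp Primrec.fst
  have h1 := Primrec.nat_div.comp hJ (primrec_pow.comp (Primrec.const 2)
    (Primrec.nat_sub.comp hn (Primrec.succ.comp Primrec.snd)))
  exact (Primrec.eq.comp (Primrec.nat_mod.comp h1 (Primrec.const 2)) (Primrec.const 1)).decide

/-- Value of a bit string, starting from `a`. -/
def valOf (a : ℕ) (s : List Bool) : ℕ := s.foldl (fun r b => 2 * r + b.toNat) a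

theorem primrec_valOf (a : ℕ) : Primrec (valOf a) := by
  unfold valOf
  refine Primrec.list_foldl (h := fun _ (q : ℕ × Bool) => 2 * q.1 + q.2.toNat) Primrec.id (Primrec.const a) ?_
  exact Primrec.nat_add.comp (Primrec.nat_mul.comp (Primrec.const 2) (Primrec.fst.comp Primrec.snd))
    ((Primrec.dom_bool Bool.toNat).comp (Primrec.snd.comp Primrec.snd))

theorem valOf_firstBits (α : ℝ) (hα : 0 ≤ α) (n : ℕ) :
    valOf ⌊α⌋₊ (firstBits α n) = ⌊α * 2 ^ n⌋₊ := by
  induction n with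
  | zero => simp [valOf, firstBits]
  | succ n ih =>
    have h : firstBits α (n + 1) = firstBits α n ++ [bitOf α n] := by
      simp [firstBits, List.range_succ]
    have e : valOf ⌊α⌋₊ (firstBits α n ++ [bitOf α n])
        = 2 * valOf ⌊α⌋₊ (firstBits α n) + (bitOf α n).toNat := by
      simp [valOf, List.foldl_append]
    rw [h, e, ih, bitOf_eq α hα]
    have := floor_div α n 1
    generalize ⌊α * 2 ^ (n + 1)⌋₊ = x at *
    rcases Nat.mod_two_eq_zero_or_one x with h | h <;> simp [h] <;> omega

theorem firstBits_length (α : ℝ) (n : ℕ) : (firstBits α n).length = n := by simp [firstBits]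

theorem exists_bits (m A : ℕ) (hA : A < 2 ^ m) : ∃ w : List Bool, w.length = m ∧ valOf 0 w = A := by
  refine ⟨firstBits (A / 2 ^ m) m, firstBits_length _ _, ?_⟩
  have h0 : (0 : ℝ) ≤ A / 2 ^ m := by positivity
  have h1 : (A : ℝ) / 2 ^ m < 1 := by
    rw [div_lt_one (by positivity)]; exact_mod_cast hA
  have := valOf_firstBits _ h0 m
  rw [Nat.floor_eq_zero.2 h1] at this
  rw [this, div_mul_cancel₀ _ (by positivity), Nat.floor_natCast]

/-! Kraft -/

theorem uniquelyDecodable_of_prefixFree (S : Set (List Bool)) (h : PrefixFree S) (h0 : [] ∉ S) :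
    InformationTheory.UniquelyDecodable S := by
  intro L₁
  induction L₁ with
  | nil =>
    intro L₂ _ h2 he
    cases L₂ with
    | nil => rfl
    | cons w L =>
      simp only [List.flatten_nil, List.flatten_cons] at he
      have : w = [] := (List.append_eq_nil_iff.1 he.symm).1
      exact absurd (this ▸ h2 w (by simp)) h0
  | cons w L ih =>
    intro L₂ h1 h2 he
    cases L₂ with
    | nil =>
      simp only [List.flatten_nil, List.flatten_cons] at he
      have : w = [] := (List.append_eq_nil_iff.1 he).1
      exact absurd (this ▸ h1 w (by simp)) h0
    | cons w' L' =>
      simp only [List.flatten_cons] at he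
      have hw : w ∈ S := h1 w (by simp)
      have hw' : w' ∈ S := h2 w' (by simp)
      have hww : w = w' := by
        rcases List.prefix_or_prefix_of_prefix (l₁ := w) (l₂ := w') (l₃ := w ++ L.flatten)
          (List.prefix_append _ _) (he ▸ List.prefix_append _ _) with hp | hp
        · exact h w hw w' hw' hp
        · exact (h w' hw' w hw hp).symm
      subst hww
      rw [List.append_cancel_left_eq] at he
      rw [ih L' (fun x hx => h1 x (by simp [hx])) (fun x hx => h2 x (by simp [hx])) he]

theorem kraft (S : Set (List Bool)) (h : PrefixFree S) (F : Finset (List Bool)) (hF : ↑F ⊆ S) :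
    ∑ p ∈ F, ((1 : ℝ) / 2) ^ p.length ≤ 1 := by
  by_cases h0 : [] ∈ F
  · have : F = {[]} := by
      ext p
      simp only [Finset.mem_singleton]
      constructor
      · intro hp
        exact (h [] (hF h0) p (hF hp) (List.nil_prefix)).symm
      · rintro rfl; exact h0
    rw [this]; simp
  · have hp : PrefixFree (F : Set (List Bool)) := fun p hp q hq => h p (hF hp) q (hF hq)
    have := InformationTheory.kraft_mcmillan_inequality (S := F)
      (uniquelyDecodable_of_prefixFree _ hp (by simpa using h0))
    simpa using this

theorem boltzmann_pos (T : ℝ) (p : List Bool) : 0 < boltzmann T p := by unfold boltzmann; positivity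

theorem boltzmann_one (p : List Bool) : boltzmann 1 p = (1 / 2) ^ p.length := by
  unfold boltzmann
  rw [div_one, Real.rpow_neg (by norm_num), Real.rpow_natCast]
  simp

theorem boltzmann_le_one (T : ℝ) (hT : 0 < T) (hT1 : T ≤ 1) (p : List Bool) :
    boltzmann T p ≤ boltzmann 1 p := by
  unfold boltzmann
  refine Real.rpow_le_rpow_of_exponent_le one_le_two ?_
  rw [neg_div, neg_div, neg_le_neg_iff]
  exact div_le_div_of_nonneg_left (by positivity) hT hT1

theorem finsum_le (V : Computer) (T : ℝ) (hT : 0 < T) (hT1 : T ≤ 1) (F : Finset (List Bool))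
    (hF : ↑F ⊆ V.f.Dom) : ∑ p ∈ F, boltzmann T p ≤ 1 := by
  refine (Finset.sum_le_sum fun p _ => boltzmann_le_one T hT hT1 p).trans ?_
  simp_rw [boltzmann_one]
  exact kraft _ V.dom_prefixFree F hF

theorem sum_subtype (V : Computer) (T : ℝ) (F : Finset V.f.Dom) :
    ∑ p ∈ F, boltzmann T p.1 = ∑ p ∈ F.map (Function.Embedding.subtype _), boltzmann T p := by
  rw [Finset.sum_map]; rfl

theorem map_subset (V : Computer) (F : Finset V.f.Dom) :
    (↑(F.map (Function.Embedding.subtype (· ∈ V.f.Dom))) : Set (List Bool)) ⊆ V.f.Dom := by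
  intro p hp
  simp only [Finset.coe_map, Set.mem_image] at hp
  obtain ⟨q, -, rfl⟩ := hp
  exact q.2

theorem summable_boltzmann (V : Computer) (T : ℝ) (hT : 0 < T) (hT1 : T ≤ 1) :
    Summable (fun p : V.f.Dom => boltzmann T p.1) := by
  refine summable_of_sum_le (c := 1) (fun p => (boltzmann_pos T _).le) fun F => ?_
  rw [sum_subtype]
  exact finsum_le V T hT hT1 _ (map_subset V F)

theorem sum_le_Z (V : Computer) (T : ℝ) (hT : 0 < T) (hT1 : T ≤ 1) (F : Finset (List Bool))
    (hF : ↑F ⊆ V.f.Dom) : ∑ p ∈ F, boltzmann T p ≤ Zfun V T := by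
  classical
  have h := (summable_boltzmann V T hT hT1).sum_le_tsum
    (F.subtype (· ∈ V.f.Dom)) (fun p _ => (boltzmann_pos T _).le)
  refine le_trans (le_of_eq ?_) h
  rw [sum_subtype, Finset.subtype_map_of_mem (fun x hx => hF hx)]

theorem Z_le_of (V : Computer) (T : ℝ) (hT : 0 < T) (hT1 : T ≤ 1) (c : ℝ)
    (H : ∀ F : Finset (List Bool), ↑F ⊆ V.f.Dom → ∑ p ∈ F, boltzmann T p ≤ c) : Zfun V T ≤ c := by
  refine (summable_boltzmann V T hT hT1).tsum_le_of_sum_le fun F => ?_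
  rw [sum_subtype]
  exact H _ (map_subset V F)

theorem Z_pos (V : Computer) (T : ℝ) (hT : 0 < T) (hT1 : T ≤ 1) : 0 < Zfun V T := by
  obtain ⟨p, hp⟩ := V.dom_nonempty
  have := sum_le_Z V T hT hT1 {p} (by simpa using hp)
  rw [Finset.sum_singleton] at this
  exact (boltzmann_pos T p).trans_le this

/-- `E` is a monotone primitive recursive enumeration of the graph of `V`. -/
structure IsEnum (V : Computer) (E : ℕ → List (List Bool × List Bool)) : Prop where
  prim : Primrec E
  nodup : ∀ k, ((E k).map Prod.fst).Nodup
  sound : ∀ k, ∀ x ∈ E k, x.2 ∈ V.f x.1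
  mono : ∀ k l, k ≤ l → E k ⊆ E l
  complete : ∀ p s, s ∈ V.f p → ∃ k, (p, s) ∈ E k

theorem exists_isEnum (V : Computer) : ∃ E, IsEnum V E := by
  obtain ⟨E, h1, h2, h3, h4, h5⟩ := enumeration V
  exact ⟨E, h1, h2, h3, h4, h5⟩

/-- The finite set of programs enumerated by stage `k`. -/
def stg (E : ℕ → List (List Bool × List Bool)) (k : ℕ) : Finset (List Bool) :=
  ((E k).map Prod.fst).toFinset

theorem mem_stg {E : ℕ → List (List Bool × List Bool)} {k : ℕ} {p : List Bool} :
    p ∈ stg E k ↔ ∃ s, (p, s) ∈ E k := by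
  simp [stg]

theorem stg_subset {V : Computer} {E : ℕ → List (List Bool × List Bool)}
    (hE : IsEnum V E) (k : ℕ) : (↑(stg E k) : Set (List Bool)) ⊆ V.f.Dom := by
  intro p hp
  obtain ⟨s, hs⟩ := mem_stg.1 (Finset.mem_coe.1 hp)
  exact Part.dom_iff_mem.2 ⟨s, hE.sound k _ hs⟩

theorem exists_stage {V : Computer} {E : ℕ → List (List Bool × List Bool)}
    (hE : IsEnum V E) (F : Finset (List Bool)) (hF : ↑F ⊆ V.f.Dom) : ∃ k, F ⊆ stg E k := by
  classical
  induction F using Finset.induction_on with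
  | empty => exact ⟨0, by simp⟩
  | insert a F _ ih =>
    obtain ⟨k, hk⟩ := ih (fun x hx => hF (by simp at hx ⊢; exact Or.inr hx))
    have ha : a ∈ V.f.Dom := hF (by simp)
    obtain ⟨s, hs⟩ := Part.dom_iff_mem.1 ha
    obtain ⟨l, hl⟩ := hE.complete a s hs
    refine ⟨max k l, fun x hx => ?_⟩
    rw [Finset.mem_insert] at hx
    rcases hx with rfl | hx
    · exact mem_stg.2 ⟨s, hE.mono _ _ (le_max_right _ _) hl⟩
    · obtain ⟨t, ht⟩ := mem_stg.1 (hk hx)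
      exact mem_stg.2 ⟨t, hE.mono _ _ (le_max_left _ _) ht⟩

theorem exists_stage_lt {V : Computer} {E : ℕ → List (List Bool × List Bool)}
    (hE : IsEnum V E) (T : ℝ) (hT : 0 < T) (hT1 : T ≤ 1) (y : ℝ) (hy : y < Zfun V T) :
    ∃ k, y < ∑ p ∈ stg E k, boltzmann T p := by
  by_contra! h
  refine absurd (Z_le_of V T hT hT1 y fun F hF => ?_) (not_le.2 hy)
  obtain ⟨k, hk⟩ := exists_stage hE F hF
  exact (Finset.sum_le_sum_of_subset_of_nonneg hk fun p _ _ => (boltzmann_pos T p).le).trans (h k)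

theorem sum_stg {V : Computer} {E : ℕ → List (List Bool × List Bool)}
    (hE : IsEnum V E) (f : List Bool → ℝ) (k : ℕ) :
    ∑ p ∈ stg E k, f p = ((E k).map fun x => f x.1).sum := by
  unfold stg
  rw [List.sum_toFinset _ (hE.nodup k), List.map_map]; rfl

theorem tail_le {V : Computer} {E : ℕ → List (List Bool × List Bool)}
    (hE : IsEnum V E) (T : ℝ) (hT : 0 < T) (hT1 : T ≤ 1) (k : ℕ) (q : List Bool) (hq : q ∈ V.f.Dom)
    (hqk : q ∉ stg E k) : ∑ p ∈ stg E k, boltzmann T p + boltzmann T q ≤ Zfun V T := by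
  classical
  have := sum_le_Z V T hT hT1 (insert q (stg E k)) (by
    intro x hx
    rw [Finset.coe_insert, Set.mem_insert_iff] at hx
    rcases hx with rfl | hx
    · exact hq
    · exact stg_subset hE k hx)
  rw [Finset.sum_insert hqk] at this
  linarith

theorem list_sum_bounds {α : Type} (l : List α) (a : α → ℕ) (b : α → ℝ)
    (h : ∀ x, (a x : ℝ) ≤ b x ∧ b x ≤ a x + 2) :
    ((l.map a).sum : ℝ) ≤ (l.map b).sum ∧ (l.map b).sum ≤ (l.map a).sum + 2 * l.length := by
  induction l with
  | nil => simp
  | cons x l ih =>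
    have := h x
    simp only [List.map_cons, List.sum_cons, List.length_cons]
    push_cast at *
    constructor <;> linarith [ih.1, ih.2]

theorem exists_weights (T : ℝ) (hT : 0 < T) (hTc : ComputableReal T) :
    ∃ W : ℕ × ℕ → ℕ, Computable W ∧
      ∀ m k, (W (m, k) : ℝ) ≤ phiT m k T ∧ phiT m k T ≤ W (m, k) + 2 := by
  obtain ⟨f, hf, hfT⟩ := hTc
  obtain ⟨u, v, hu, hv, huv⟩ := computable_rat f hf
  refine weights T hT u v hu hv (fun n => by rw [(huv n).2]; exact (f n).den_pos) fun N hN => ?_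
  have h := hfT N hN
  rw [(huv N).1, (huv N).2]
  by_cases hn : 0 ≤ (f N).num
  · have e : (((f N).num.toNat : ℕ) : ℝ) = ((f N).num : ℝ) := by
      exact_mod_cast Int.toNat_of_nonneg hn
    rw [e, ← Rat.cast_def]
    exact h
  · have e : (f N).num.toNat = 0 := by omega
    have hneg : (f N : ℝ) < 0 := by
      have : f N < 0 := Rat.num_neg.1 (by omega)
      exact_mod_cast this
    rw [e]
    simp only [Nat.cast_zero, zero_div, sub_zero]
    rw [abs_of_pos hT]
    rw [abs_of_pos (by linarith)] at h
    linarith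

theorem exists_G {V : Computer} {E : ℕ → List (List Bool × List Bool)} (hE : IsEnum V E)
    (T : ℝ) (hT : 0 < T) (hTc : ComputableReal T) :
    ∃ G : ℕ × ℕ → ℕ, Computable G ∧ ∀ k j,
      (G (k, j) : ℝ) ≤ 2 ^ j * ∑ p ∈ stg E k, boltzmann T p ∧
      2 ^ j * ∑ p ∈ stg E k, boltzmann T p ≤ G (k, j) + 2 * (E k).length := by
  obtain ⟨W, hW, hWb⟩ := exists_weights T hT hTc
  refine ⟨fun a => ((E a.1).map fun x => W (x.1.length, a.2)).sum, ?_, fun k j => ?_⟩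
  · refine computable_listSum (fun a : ℕ × ℕ => E a.1)
      (fun a (x : List Bool × List Bool) => W (x.1.length, a.2))
      (hE.prim.comp Primrec.fst).to_comp ?_
    refine hW.comp (Computable.pair ?_ ?_)
    · exact (Primrec.list_length.comp (Primrec.fst.comp Primrec.snd)).to_comp
    · exact (Primrec.snd.comp Primrec.fst).to_comp
  · have h := list_sum_bounds (E k) (fun x => W (x.1.length, j)) (fun x => 2 ^ j * boltzmann T x.1)
      (fun x => hWb x.1.length j)
    rw [sum_stg hE, ← List.sum_map_mul_left]
    exact h

theorem optimal_surj (U : Computer) (hU : Optimal U) (s : List Bool) : ∃ p, s ∈ U.f p := by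
  obtain ⟨F, hF, hd, ho⟩ := search_partrec (α := List Bool) (β := ℕ) (γ := List Bool)
    (fun p _ => decide (p = []))
    ((Primrec.eq.comp Primrec.fst (Primrec.const [])).decide.to_comp)
    (fun _ _ => s) (Computable.const s)
  have hd' : ∀ p, p ∈ F.Dom ↔ p = [] := fun p => by
    rw [PFun.mem_dom, ← Part.dom_iff_mem, hd]; simp
  obtain ⟨d, hd2⟩ := hU ⟨F, hF, ⟨[], (hd' _).2 rfl⟩, fun p hp q hq _ => by
    rw [(hd' p).1 hp, (hd' q).1 hq]⟩
  obtain ⟨q, hq, -⟩ := hd2 [] ((hd' _).2 rfl)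
  obtain ⟨y, hy⟩ := (PFun.mem_dom F []).1 ((hd' _).2 rfl)
  obtain ⟨_, -, rfl⟩ := ho [] y hy
  exact ⟨q, by rw [hq]; exact hy⟩

theorem complexity_spec (U : Computer) (hU : Optimal U) (s : List Bool) :
    ∃ p, s ∈ U.f p ∧ p.length = complexity U s := by
  obtain ⟨p, hp⟩ := optimal_surj U hU s
  exact Nat.sInf_mem (s := {n | ∃ p : List Bool, s ∈ U.f p ∧ p.length = n}) ⟨_, p, hp, rfl⟩

theorem complexity_le (U : Computer) (s p : List Bool) (hp : s ∈ U.f p) :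
    complexity U s ≤ p.length := Nat.sInf_le ⟨p, hp, rfl⟩

/-- Search predicate for the randomness part. -/
def randPred (a : ℕ) (G : ℕ × ℕ → ℕ) (s : List Bool) (x : ℕ × ℕ) : Bool :=
  decide (valOf a s * 2 ^ x.2 < G x * 2 ^ s.length + 2 ^ x.2)

theorem computable_randPred (a : ℕ) (G : ℕ × ℕ → ℕ) (hG : Computable G) :
    Computable₂ (randPred a G) := by
  have hj : Computable (fun q : List Bool × (ℕ × ℕ) => 2 ^ q.2.2) :=
    (primrec_pow.comp (Primrec.const 2) (Primrec.snd.comp Primrec.snd)).to_comp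
  have hs : Computable (fun q : List Bool × (ℕ × ℕ) => 2 ^ q.1.length) :=
    (primrec_pow.comp (Primrec.const 2) (Primrec.list_length.comp Primrec.fst)).to_comp
  have hv : Computable (fun q : List Bool × (ℕ × ℕ) => valOf a q.1) :=
    ((primrec_valOf a).comp Primrec.fst).to_comp
  have hg : Computable (fun q : List Bool × (ℕ × ℕ) => G q.2) := hG.comp Computable.snd
  have h1 := Primrec.nat_mul.to_comp.comp hv hj
  have h2 := Primrec.nat_add.to_comp.comp (Primrec.nat_mul.to_comp.comp hg hs) hj
  exact (Primrec.nat_lt.decide.to_comp).comp h1 h2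

/-- A string differing from all outputs of stage `k`. -/
def fresh (E : ℕ → List (List Bool × List Bool)) (_ : List Bool) (x : ℕ × ℕ) : List Bool :=
  true :: ((E x.1).map Prod.snd).flatten

theorem computable_fresh (E : ℕ → List (List Bool × List Bool)) (hE : Primrec E) :
    Computable₂ (fresh E) := by
  refine Primrec₂.to_comp ?_
  refine Primrec.list_cons.comp (Primrec.const true) (Primrec.list_flatten.comp ?_)
  exact Primrec.list_map (hE.comp (Primrec.fst.comp Primrec.snd)) (Primrec.snd.comp Primrec.snd)

theorem fresh_ne (E : ℕ → List (List Bool × List Bool)) (t : List Bool) (x : ℕ × ℕ)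
    (p s : List Bool) (h : (p, s) ∈ E x.1) : s ≠ fresh E t x := by
  intro e
  have hs : s ∈ (E x.1).map Prod.snd := List.mem_map.2 ⟨_, h, rfl⟩
  have h1 : s.length ≤ ((E x.1).map Prod.snd).flatten.length := (List.sublist_flatten_of_mem hs).length_le
  rw [e] at h1
  simp [fresh] at h1

theorem randPred_exists {V : Computer} {E : ℕ → List (List Bool × List Bool)} (hE : IsEnum V E)
    (T : ℝ) (hT : 0 < T) (hT1 : T ≤ 1) (G : ℕ × ℕ → ℕ)
    (hG : ∀ k j, 2 ^ j * ∑ p ∈ stg E k, boltzmann T p ≤ G (k, j) + 2 * (E k).length) (n : ℕ) :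
    ∃ x, randPred ⌊Zfun V T⌋₊ G (firstBits (Zfun V T) n) x = true := by
  have hZ := (Z_pos V T hT hT1).le
  have hp : (0 : ℝ) < 2 ^ n := by positivity
  have h1 : (⌊Zfun V T * 2 ^ n⌋₊ : ℝ) ≤ Zfun V T * 2 ^ n := Nat.floor_le (by positivity)
  obtain ⟨k, hk⟩ := exists_stage_lt hE T hT hT1 (((⌊Zfun V T * 2 ^ n⌋₊ : ℝ) - 1) / 2 ^ n)
    (by rw [div_lt_iff₀ hp]; linarith)
  rw [div_lt_iff₀ hp] at hk
  set S := ∑ p ∈ stg E k, boltzmann T p with hS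
  have hε : 0 < S * 2 ^ n - ((⌊Zfun V T * 2 ^ n⌋₊ : ℝ) - 1) := by linarith
  obtain ⟨j, hj⟩ := pow_unbounded_of_one_lt
    ((2 * (E k).length * 2 ^ n) / (S * 2 ^ n - ((⌊Zfun V T * 2 ^ n⌋₊ : ℝ) - 1))) (one_lt_two (α := ℝ))
  rw [div_lt_iff₀ hε] at hj
  refine ⟨(k, j), ?_⟩
  unfold randPred
  rw [decide_eq_true_iff, valOf_firstBits _ hZ, firstBits_length]
  have h2 := mul_le_mul_of_nonneg_right (hG k j) hp.le
  rw [← hS] at h2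
  have : (⌊Zfun V T * 2 ^ n⌋₊ : ℝ) * 2 ^ j < G (k, j) * 2 ^ n + 2 ^ j := by nlinarith
  exact_mod_cast this

theorem randPred_sound {V : Computer} {E : ℕ → List (List Bool × List Bool)}
    (T : ℝ) (hT : 0 < T) (hT1 : T ≤ 1) (G : ℕ × ℕ → ℕ)
    (hG : ∀ k j, (G (k, j) : ℝ) ≤ 2 ^ j * ∑ p ∈ stg E k, boltzmann T p) (n : ℕ) (x : ℕ × ℕ)
    (h : randPred ⌊Zfun V T⌋₊ G (firstBits (Zfun V T) n) x = true) :
    Zfun V T - ∑ p ∈ stg E x.1, boltzmann T p < 2 / 2 ^ n := by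
  obtain ⟨k, j⟩ := x
  have hZ := (Z_pos V T hT hT1).le
  unfold randPred at h
  rw [decide_eq_true_iff, valOf_firstBits _ hZ, firstBits_length] at h
  have h' : (⌊Zfun V T * 2 ^ n⌋₊ : ℝ) * 2 ^ j < G (k, j) * 2 ^ n + 2 ^ j := by exact_mod_cast h
  have hp : (0 : ℝ) < 2 ^ n := by positivity
  have hq : (0 : ℝ) < 2 ^ j := by positivity
  have h1 := mul_le_mul_of_nonneg_right (hG k j) hp.le
  have h2 := Nat.lt_floor_add_one (Zfun V T * 2 ^ n)
  rw [lt_div_iff₀ hp]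
  set S := ∑ p ∈ stg E k, boltzmann T p
  have h3 : (⌊Zfun V T * 2 ^ n⌋₊ : ℝ) < S * 2 ^ n + 1 := by
    refine lt_of_mul_lt_mul_right (lt_of_lt_of_le h' ?_) hq.le
    linarith
  show (Zfun V T - S) * 2 ^ n < 2
  linarith

theorem length_of_boltzmann_lt (T : ℝ) (hT : 0 < T) (hT1 : T ≤ 1) (n : ℕ) (q : List Bool)
    (h : boltzmann T q < 2 / 2 ^ n) : T * n - 1 ≤ q.length := by
  have e : (2 : ℝ) / 2 ^ n = 2 ^ (1 - (n : ℝ)) := by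
    rw [Real.rpow_sub two_pos, Real.rpow_one, Real.rpow_natCast]
  rw [e, boltzmann, Real.rpow_lt_rpow_left_iff one_lt_two, div_lt_iff₀ hT] at h
  nlinarith

theorem weak_random (U : Computer) (hU : Optimal U) (V : Computer) (hV : Optimal V)
    (T : ℝ) (hT : 0 < T) (hT1 : T ≤ 1) (hTc : ComputableReal T) :
    WeaklyChaitinTRandom U T (Zfun V T) := by
  obtain ⟨E, hE⟩ := exists_isEnum V
  obtain ⟨G, hG, hGb⟩ := exists_G hE T hT hTc
  obtain ⟨F, hF, hFd, hFo⟩ := search_partrec (randPred ⌊Zfun V T⌋₊ G)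
    (computable_randPred _ G hG) (fresh E) (computable_fresh E hE.prim)
  have hdef : ∀ n, (F (firstBits (Zfun V T) n)).Dom := fun n =>
    (hFd _).2 (randPred_exists hE T hT hT1 G (fun k j => (hGb k j).2) n)
  let f : List Bool →. List Bool := fun p => (U.f p).bind F
  have hfd : ∀ p, p ∈ f.Dom → p ∈ U.f.Dom := by
    intro p hp
    obtain ⟨y, hy⟩ := (PFun.mem_dom _ _).1 hp
    obtain ⟨z, hz, -⟩ := Part.mem_bind_iff.1 hy
    exact (PFun.mem_dom _ _).2 ⟨z, hz⟩
  have hmem : ∀ p n, firstBits (Zfun V T) n ∈ U.f p → f p = F (firstBits (Zfun V T) n) := by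
    intro p n hp
    show (U.f p).bind F = _
    rw [Part.eq_some_iff.2 hp]
    exact Part.bind_some _ _
  let C : Computer := ⟨f, Partrec.bind U.partrec (hF.comp Computable.snd), by
    obtain ⟨p, hp⟩ := optimal_surj U hU (firstBits (Zfun V T) 0)
    refine ⟨p, ?_⟩
    show (f p).Dom
    rw [hmem p 0 hp]; exact hdef 0, fun p hp q hq h => U.dom_prefixFree p (hfd p hp) q (hfd q hq) h⟩
  obtain ⟨d, hd⟩ := hV C
  refine ⟨d + 1, fun n _ => ?_⟩
  obtain ⟨p, hp, hpl⟩ := complexity_spec U hU (firstBits (Zfun V T) n)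
  have hCp : C.f p = F (firstBits (Zfun V T) n) := hmem p n hp
  have hpd : p ∈ C.f.Dom := by
    show (C.f p).Dom
    rw [hCp]; exact hdef n
  obtain ⟨q, hq, hql⟩ := hd p hpd
  rw [hCp] at hq
  obtain ⟨y, hy⟩ := Part.dom_iff_mem.1 (hdef n)
  obtain ⟨x, hx, rfl⟩ := hFo _ _ hy
  have hqd : q ∈ V.f.Dom := (PFun.mem_dom _ _).2 ⟨_, by rw [hq]; exact hy⟩
  have hqk : q ∉ stg E x.1 := by
    intro h
    obtain ⟨s, hs⟩ := mem_stg.1 h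
    refine fresh_ne E (firstBits (Zfun V T) n) x q s hs ?_
    have h1 : s ∈ V.f q := hE.sound _ _ hs
    rw [hq] at h1
    exact Part.mem_unique h1 hy
  have h1 := tail_le hE T hT hT1 x.1 q hqd hqk
  have h2 := randPred_sound T hT hT1 G (fun k j => (hGb k j).1) n x hx
  have h3 := length_of_boltzmann_lt T hT hT1 n q (by linarith)
  have h4 : (q.length : ℝ) ≤ complexity U (firstBits (Zfun V T) n) + d := by
    rw [← hpl]; exact_mod_cast hql
  push_cast
  linarith

/-- Unary prefix code. -/
def una (a : ℕ) (r : List Bool) : List Bool := (List.range a).map (fun _ => true) ++ false :: r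

theorem una_eq (a : ℕ) (r : List Bool) : una a r = List.replicate a true ++ false :: r := by
  simp [una]

theorem una_prefix (a : ℕ) : ∀ (a' : ℕ) (r r' : List Bool), una a r <+: una a' r' →
    a = a' ∧ r <+: r' := by
  simp only [una_eq]
  induction a with
  | zero =>
    intro a' r r' h
    cases a' with
    | zero => simpa using h
    | succ a' => simp [List.replicate_succ] at h
  | succ a ih =>
    intro a' r r' h
    cases a' with
    | zero => simp [List.replicate_succ] at h
    | succ a' =>
      simp only [List.replicate_succ, List.cons_append, List.cons_prefix_cons, true_and] at h
      have := ih a' r r' h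
      exact ⟨by omega, this.2⟩

theorem primrec_una : Primrec₂ una := by
  unfold una
  refine Primrec.list_append.comp ?_ (Primrec.list_cons.comp (Primrec.const false) Primrec.snd)
  exact Primrec.list_map (Primrec.list_range.comp Primrec.fst) (Primrec.const true)

/-- Data encoded in a program. -/
abbrev PD := (ℕ × ℕ) × (ℕ × ℕ) × List Bool

/-- Encoding of a program. -/
def encP (x : PD) : List Bool := una x.1.1 (una x.1.2 (una x.2.1.1 (una x.2.1.2 x.2.2)))

/-- The precision. -/
def nP (x : PD) : ℕ := Nat.pair x.1.1 x.1.2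

/-- The number of bits of the halting probability. -/
def mP (x : PD) : ℕ := Nat.pair x.2.1.1 x.2.1.2

theorem primrec_encP : Primrec encP := by
  have h1 : Primrec (fun x : PD => x.1.1) := Primrec.fst.comp Primrec.fst
  have h2 : Primrec (fun x : PD => x.1.2) := Primrec.snd.comp Primrec.fst
  have h3 : Primrec (fun x : PD => x.2.1.1) := Primrec.fst.comp (Primrec.fst.comp Primrec.snd)
  have h4 : Primrec (fun x : PD => x.2.1.2) := Primrec.snd.comp (Primrec.fst.comp Primrec.snd)
  have h5 : Primrec (fun x : PD => x.2.2) := Primrec.snd.comp Primrec.snd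
  exact primrec_una.comp h1 (primrec_una.comp h2 (primrec_una.comp h3 (primrec_una.comp h4 h5)))

theorem primrec_nP : Primrec nP :=
  Primrec₂.natPair.comp (Primrec.fst.comp Primrec.fst) (Primrec.snd.comp Primrec.fst)

theorem primrec_mP : Primrec mP :=
  Primrec₂.natPair.comp (Primrec.fst.comp (Primrec.fst.comp Primrec.snd))
    (Primrec.snd.comp (Primrec.fst.comp Primrec.snd))

theorem encP_prefix (x y : PD) (hx : x.2.2.length = mP x) (hy : y.2.2.length = mP y)
    (h : encP x <+: encP y) : x = y := by
  obtain ⟨⟨a, b⟩, ⟨c, d⟩, w⟩ := x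
  obtain ⟨⟨a', b'⟩, ⟨c', d'⟩, w'⟩ := y
  obtain ⟨rfl, h⟩ := una_prefix _ _ _ _ h
  obtain ⟨rfl, h⟩ := una_prefix _ _ _ _ h
  obtain ⟨rfl, h⟩ := una_prefix _ _ _ _ h
  obtain ⟨rfl, h⟩ := una_prefix _ _ _ _ h
  simp only [mP] at hx hy h
  rw [h.eq_of_length (by rw [hx, hy])]

theorem encP_length (x : PD) :
    (encP x).length = x.1.1 + x.1.2 + x.2.1.1 + x.2.1.2 + 4 + x.2.2.length := by
  simp [encP, una]; omega

theorem unpair_le_sqrt (n : ℕ) : n.unpair.1 ≤ n.sqrt ∧ n.unpair.2 ≤ n.sqrt := by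
  have := Nat.sqrt_le_add n
  unfold Nat.unpair
  simp only
  split_ifs with h
  · simp only; omega
  · simp only; omega

/-- Search predicate for the compressibility part. -/
def compPred (G₁ : ℕ × ℕ → ℕ) (p : List Bool) (x : PD × (ℕ × ℕ)) : Bool :=
  decide (encP x.1 = p) && (decide (x.1.2.2.length = mP x.1) &&
    decide (valOf 0 x.1.2.2 * 2 ^ x.2.2 ≤ 2 ^ mP x.1 * G₁ x.2))

theorem compPred_iff (G₁ : ℕ × ℕ → ℕ) (p : List Bool) (x : PD × (ℕ × ℕ)) :
    compPred G₁ p x = true ↔ encP x.1 = p ∧ x.1.2.2.length = mP x.1 ∧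
      valOf 0 x.1.2.2 * 2 ^ x.2.2 ≤ 2 ^ mP x.1 * G₁ x.2 := by
  simp [compPred]

theorem computable_compPred (G₁ : ℕ × ℕ → ℕ) (hG : Computable G₁) : Computable₂ (compPred G₁) := by
  have hx : Primrec (fun q : List Bool × (PD × (ℕ × ℕ)) => q.2.1) := Primrec.fst.comp Primrec.snd
  have hw : Primrec (fun q : List Bool × (PD × (ℕ × ℕ)) => q.2.1.2.2) :=
    Primrec.snd.comp (Primrec.snd.comp hx)
  have hm := primrec_mP.comp hx
  have h1 := (Primrec.eq.comp (primrec_encP.comp hx) Primrec.fst).decide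
  have h2 := (Primrec.eq.comp (Primrec.list_length.comp hw) hm).decide
  have h3 := Primrec.nat_mul.comp ((primrec_valOf 0).comp hw) (primrec_pow.comp (Primrec.const 2)
    (Primrec.snd.comp (Primrec.snd.comp Primrec.snd)))
  have hg : Computable (fun q : List Bool × (PD × (ℕ × ℕ)) => G₁ q.2.2) :=
    hG.comp (Computable.snd.comp Computable.snd)
  have h4 := Primrec.nat_mul.to_comp.comp (primrec_pow.comp (Primrec.const 2) hm).to_comp hg
  have h5 := (Primrec.nat_le.decide.to_comp).comp h3.to_comp h4
  exact Primrec.and.to_comp.comp h1.to_comp (Primrec.and.to_comp.comp h2.to_comp h5)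

/-- Output of the search. -/
def compOut (E : ℕ → List (List Bool × List Bool)) (G : ℕ × ℕ → ℕ) (_ : List Bool)
    (x : PD × (ℕ × ℕ)) : ℕ × ℕ :=
  (nP x.1, G (x.2.1, nP x.1 + 2 * (E x.2.1).length) / 2 ^ (2 * (E x.2.1).length))

theorem computable_compOut (E : ℕ → List (List Bool × List Bool)) (hE : Primrec E)
    (G : ℕ × ℕ → ℕ) (hG : Computable G) : Computable₂ (compOut E G) := by
  have hn : Primrec (fun q : List Bool × (PD × (ℕ × ℕ)) => nP q.2.1) :=
    primrec_nP.comp (Primrec.fst.comp Primrec.snd)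
  have hk : Primrec (fun q : List Bool × (PD × (ℕ × ℕ)) => q.2.2.1) :=
    Primrec.fst.comp (Primrec.snd.comp Primrec.snd)
  have hl : Primrec (fun q : List Bool × (PD × (ℕ × ℕ)) => 2 * (E q.2.2.1).length) :=
    Primrec.nat_mul.comp (Primrec.const 2) (Primrec.list_length.comp (hE.comp hk))
  have h1 := hG.comp (Computable.pair hk.to_comp (Primrec.nat_add.comp hn hl).to_comp)
  have h2 := Primrec.nat_div.to_comp.comp h1 (primrec_pow.comp (Primrec.const 2) hl).to_comp
  exact Computable.pair hn.to_comp h2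

theorem boltzmann_split (T : ℝ) (hT : 0 < T) (hT1 : T ≤ 1) (m : ℕ) (p : List Bool)
    (h : boltzmann 1 p ≤ (1 / 2) ^ m) :
    boltzmann T p ≤ boltzmann 1 p * 2 ^ ((m : ℝ) - m / T) := by
  rw [boltzmann_one] at h
  have hm : m ≤ p.length := (pow_le_pow_iff_right_of_lt_one₀ (by norm_num) (by norm_num)).1 h
  unfold boltzmann
  rw [← Real.rpow_add two_pos]
  refine Real.rpow_le_rpow_of_exponent_le one_le_two ?_
  have h1 : (1 : ℝ) ≤ 1 / T := by rw [le_div_iff₀ hT]; linarith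
  have hm' : (m : ℝ) ≤ p.length := by exact_mod_cast hm
  have e : -(p.length : ℝ) / T = -(p.length * (1 / T)) := by ring
  have e2 : (m : ℝ) / T = m * (1 / T) := by ring
  rw [e, e2]
  nlinarith

theorem Z_tail {V : Computer} {E : ℕ → List (List Bool × List Bool)} (hE : IsEnum V E)
    (T : ℝ) (hT : 0 < T) (hT1 : T ≤ 1) (m k : ℕ)
    (h : Zfun V 1 - ∑ p ∈ stg E k, boltzmann 1 p ≤ (1 / 2) ^ m) :
    Zfun V T ≤ ∑ p ∈ stg E k, boltzmann T p + 2 ^ (-(m : ℝ) / T) := by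
  classical
  refine Z_le_of V T hT hT1 _ fun F hF => ?_
  have h1 : ∑ p ∈ F ∩ stg E k, boltzmann T p ≤ ∑ p ∈ stg E k, boltzmann T p :=
    Finset.sum_le_sum_of_subset_of_nonneg Finset.inter_subset_right
      fun p _ _ => (boltzmann_pos T p).le
  have h2 : ∑ p ∈ F \ stg E k, boltzmann 1 p ≤ (1 / 2) ^ m := by
    have := sum_le_Z V 1 one_pos le_rfl ((F \ stg E k) ∪ stg E k) (by
      intro x hx
      simp only [Finset.coe_union, Set.mem_union, Finset.mem_coe, Finset.mem_sdiff] at hx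
      rcases hx with hx | hx
      · exact hF hx.1
      · exact stg_subset hE k hx)
    rw [Finset.sum_union Finset.sdiff_disjoint] at this
    linarith
  have h3 : ∑ p ∈ F \ stg E k, boltzmann T p
      ≤ ∑ p ∈ F \ stg E k, boltzmann 1 p * 2 ^ ((m : ℝ) - m / T) := by
    refine Finset.sum_le_sum fun p hp => boltzmann_split T hT hT1 m p ?_
    rw [Finset.mem_sdiff] at hp
    have := tail_le hE 1 one_pos le_rfl k p (hF hp.1) hp.2
    linarith
  rw [← Finset.sum_mul] at h3
  have h4 : ((1 : ℝ) / 2) ^ m * 2 ^ ((m : ℝ) - m / T) = 2 ^ (-(m : ℝ) / T) := by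
    have : ((1 : ℝ) / 2) ^ m = 2 ^ (-(m : ℝ)) := by
      rw [Real.rpow_neg two_pos.le, Real.rpow_natCast]; simp
    rw [this, ← Real.rpow_add two_pos]
    congr 1; ring
  have h5 : ∑ p ∈ F \ stg E k, boltzmann T p ≤ 2 ^ (-(m : ℝ) / T) := by
    rw [← h4]
    exact h3.trans (mul_le_mul_of_nonneg_right h2 (by positivity))
  have h6 := Finset.sum_inter_add_sum_sdiff F (stg E k) (boltzmann T)
  linarith

theorem floor_bound (Z S : ℝ) (n l G : ℕ) (hZ : 0 ≤ Z) (hS : S ≤ Z) (hZS : Z ≤ S + (1 / 2) ^ n)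
    (h1 : (G : ℝ) ≤ 2 ^ (n + 2 * l) * S) (h2 : 2 ^ (n + 2 * l) * S ≤ G + 2 * l) :
    ∃ e : Fin 3, ⌊Z * 2 ^ n⌋₊ = G / 2 ^ (2 * l) + e := by
  set J := G / 2 ^ (2 * l) with hJ
  have hp : (0 : ℝ) < 2 ^ (2 * l) := by positivity
  have hn : (0 : ℝ) < 2 ^ n := by positivity
  have a1 : J * 2 ^ (2 * l) ≤ G := Nat.div_mul_le_self _ _
  have a2 : G < (J + 1) * 2 ^ (2 * l) := by
    have := Nat.lt_div_mul_add (a := G) (b := 2 ^ (2 * l)) (by positivity)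
    rw [← hJ] at this
    linarith
  have a3 : 2 * l < 2 ^ (2 * l) := Nat.lt_two_pow_self
  have b1 : (J : ℝ) * 2 ^ (2 * l) ≤ G := by exact_mod_cast a1
  have b2 : (G : ℝ) < (J + 1) * 2 ^ (2 * l) := by exact_mod_cast a2
  have b3 : (2 : ℝ) * l < 2 ^ (2 * l) := by exact_mod_cast a3
  rw [pow_add] at h1 h2
  have c1 : (J : ℝ) ≤ S * 2 ^ n := le_of_mul_le_mul_right (by linarith) hp
  have c2 : S * 2 ^ n < J + 2 := lt_of_mul_lt_mul_right (by linarith) hp.le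
  have d : ((1 : ℝ) / 2) ^ n * 2 ^ n = 1 := by rw [← mul_pow]; norm_num
  have c3 : Z * 2 ^ n ≤ S * 2 ^ n + 1 := by
    have := mul_le_mul_of_nonneg_right hZS hn.le
    linarith
  have c4 : S * 2 ^ n ≤ Z * 2 ^ n := mul_le_mul_of_nonneg_right hS hn.le
  have f1 : J ≤ ⌊Z * 2 ^ n⌋₊ := Nat.le_floor (by linarith)
  have f2 : ⌊Z * 2 ^ n⌋₊ < J + 3 := by
    rw [Nat.floor_lt (by positivity)]; push_cast; linarith
  exact ⟨⟨⌊Z * 2 ^ n⌋₊ - J, by omega⟩, by simp only; omega⟩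

theorem exists_approx (Ω : ℝ) (h0 : 0 < Ω) (h1 : Ω ≤ 1) (m : ℕ) :
    ∃ A : ℕ, A < 2 ^ m ∧ (A : ℝ) < 2 ^ m * Ω ∧ 2 ^ m * Ω ≤ A + 1 := by
  have hp : (0 : ℝ) < 2 ^ m := by positivity
  have hc : 0 < ⌈2 ^ m * Ω⌉₊ := Nat.ceil_pos.2 (by positivity)
  obtain ⟨A, hA⟩ : ∃ A, ⌈2 ^ m * Ω⌉₊ = A + 1 := ⟨_, (Nat.succ_pred_eq_of_pos hc).symm⟩
  refine ⟨A, ?_, Nat.lt_ceil.1 (by omega), ?_⟩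
  · have : ⌈2 ^ m * Ω⌉₊ ≤ 2 ^ m := by
      rw [Nat.ceil_le]; push_cast; nlinarith
    omega
  · have := Nat.le_ceil (2 ^ m * Ω)
    rw [hA] at this
    exact_mod_cast this

theorem compPred_exists {V : Computer} {E : ℕ → List (List Bool × List Bool)} (hE : IsEnum V E)
    (G₁ : ℕ × ℕ → ℕ)
    (hG : ∀ k j, 2 ^ j * ∑ p ∈ stg E k, boltzmann 1 p ≤ G₁ (k, j) + 2 * (E k).length)
    (x : PD) (hx : x.2.2.length = mP x) (hA : (valOf 0 x.2.2 : ℝ) < 2 ^ mP x * Zfun V 1) :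
    ∃ y, compPred G₁ (encP x) y = true := by
  have hp : (0 : ℝ) < 2 ^ mP x := by positivity
  obtain ⟨k, hk⟩ := exists_stage_lt hE 1 one_pos le_rfl ((valOf 0 x.2.2 : ℝ) / 2 ^ mP x)
    (by rw [div_lt_iff₀ hp]; linarith)
  rw [div_lt_iff₀ hp] at hk
  set S := ∑ p ∈ stg E k, boltzmann 1 p with hS
  have hε : 0 < S * 2 ^ mP x - valOf 0 x.2.2 := by linarith
  obtain ⟨j, hj⟩ := pow_unbounded_of_one_lt
    ((2 * (E k).length * 2 ^ mP x) / (S * 2 ^ mP x - valOf 0 x.2.2)) (one_lt_two (α := ℝ))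
  rw [div_lt_iff₀ hε] at hj
  refine ⟨(x, (k, j)), (compPred_iff _ _ _).2 ⟨rfl, hx, ?_⟩⟩
  have h2 := mul_le_mul_of_nonneg_right (hG k j) hp.le
  rw [← hS] at h2
  have : (valOf 0 x.2.2 : ℝ) * 2 ^ j ≤ 2 ^ mP x * G₁ (k, j) := by nlinarith
  exact_mod_cast this

theorem g_tendsto (c : ℝ) : Tendsto (fun n : ℕ => (4 * Real.sqrt n + c) / n) atTop (nhds 0) := by
  have h1 : Tendsto (fun n : ℕ => (Real.sqrt n)⁻¹) atTop (nhds 0) :=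
    tendsto_inv_atTop_zero.comp (Real.tendsto_sqrt_atTop.comp tendsto_natCast_atTop_atTop)
  have h2 : Tendsto (fun n : ℕ => c / (n : ℝ)) atTop (nhds 0) := tendsto_const_div_atTop_nhds_zero_nat c
  have h3 := (h1.const_mul 4).add h2
  simp only [mul_zero, add_zero] at h3
  refine h3.congr fun n => ?_
  rw [add_div, mul_div_assoc, Real.sqrt_div_self]

theorem compressible (U : Computer) (hU : Optimal U) (V : Computer)
    (T : ℝ) (hT : 0 < T) (hT1 : T ≤ 1) (hTc : ComputableReal T) :
    TCompressible U T (Zfun V T) := by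
  obtain ⟨E, hE⟩ := exists_isEnum V
  obtain ⟨G, hG, hGb⟩ := exists_G hE T hT hTc
  obtain ⟨G₁, hG₁, hG₁b⟩ := exists_G hE 1 one_pos
    ⟨fun _ => 1, Computable.const 1, fun n hn => by simp [hn]⟩
  obtain ⟨F, hF, hFd, hFo⟩ := search_partrec (compPred G₁)
    (computable_compPred G₁ hG₁) (compOut E G) (computable_compOut E hE.prim G hG)
  have hΩ0 := Z_pos V 1 one_pos le_rfl
  have hΩ1 : Zfun V 1 ≤ 1 := Z_le_of V 1 one_pos le_rfl 1 (finsum_le V 1 one_pos le_rfl)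
  have hZ0 := (Z_pos V T hT hT1).le
  -- the key fact
  have key : ∀ n : ℕ, ∃ p : List Bool, (p.length : ℝ) ≤ T * n + 4 * Real.sqrt n + 5 ∧
      ∃ y ∈ F p, ∃ e : Fin 3, bitsOf y.1 (y.2 + e) = firstBits (Zfun V T) n := by
    intro n
    set m := ⌈T * n⌉₊ with hm
    obtain ⟨A, hA1, hA2, hA3⟩ := exists_approx (Zfun V 1) hΩ0 hΩ1 m
    obtain ⟨w, hw, hwA⟩ := exists_bits m A hA1
    let x : PD := (n.unpair, m.unpair, w)
    have hxm : mP x = m := Nat.pair_unpair m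
    have hxn : nP x = n := Nat.pair_unpair n
    have hxw : x.2.2.length = mP x := by rw [hxm]; exact hw
    have hxA : valOf 0 x.2.2 = A := hwA
    refine ⟨encP x, ?_, ?_⟩
    · have hmn : m ≤ n := by
        rw [hm, Nat.ceil_le]
        have : (0 : ℝ) ≤ n := by positivity
        nlinarith
      have h1 := unpair_le_sqrt n
      have h2 := unpair_le_sqrt m
      have h3 := Nat.sqrt_le_sqrt hmn
      have h4 : (encP x).length ≤ 4 * n.sqrt + 4 + m := by
        rw [encP_length]
        show n.unpair.1 + n.unpair.2 + m.unpair.1 + m.unpair.2 + 4 + w.length ≤ _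
        omega
      have h5 : ((encP x).length : ℝ) ≤ 4 * n.sqrt + 4 + m := by exact_mod_cast h4
      have h6 : (n.sqrt : ℝ) ≤ Real.sqrt n := Real.nat_sqrt_le_real_sqrt
      have h7 : (m : ℝ) < T * n + 1 := Nat.ceil_lt_add_one (by positivity)
      linarith
    · have hd : (F (encP x)).Dom := (hFd _).2 (compPred_exists hE G₁ (fun k j => (hG₁b k j).2) x hxw
        (by rw [hxA, hxm]; exact hA2))
      obtain ⟨y, hy⟩ := Part.dom_iff_mem.1 hd
      refine ⟨y, hy, ?_⟩
      obtain ⟨⟨x', k, j⟩, hb, rfl⟩ := hFo _ _ hy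
      obtain ⟨hb1, hb2, hb3⟩ := (compPred_iff _ _ _).1 hb
      have hxx : x' = x := encP_prefix x' x hb2 hxw (by rw [hb1])
      subst hxx
      simp only at hb3
      rw [hxA, hxm] at hb3
      have hb4 : (A : ℝ) * 2 ^ j ≤ 2 ^ m * G₁ (k, j) := by exact_mod_cast hb3
      have hpm : (0 : ℝ) < 2 ^ m := by positivity
      have hpj : (0 : ℝ) < 2 ^ j := by positivity
      have hb5 : (A : ℝ) ≤ 2 ^ m * ∑ p ∈ stg E k, boltzmann 1 p := by
        have := mul_le_mul_of_nonneg_left (hG₁b k j).1 hpm.le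
        exact le_of_mul_le_mul_right (by linarith) hpj
      have ht : Zfun V 1 - ∑ p ∈ stg E k, boltzmann 1 p ≤ (1 / 2) ^ m := by
        rw [one_div, inv_pow, ← one_div, le_div_iff₀ hpm]
        linarith
      have hz := Z_tail hE T hT hT1 m k ht
      have hz2 : (2 : ℝ) ^ (-(m : ℝ) / T) ≤ (1 / 2) ^ n := by
        have e : ((1 : ℝ) / 2) ^ n = 2 ^ (-(n : ℝ)) := by
          rw [Real.rpow_neg two_pos.le, Real.rpow_natCast]; simp
        rw [e]
        refine Real.rpow_le_rpow_of_exponent_le one_le_two ?_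
        rw [div_le_iff₀ hT]
        have := Nat.le_ceil (T * n)
        rw [← hm] at this
        linarith
      obtain ⟨e, he⟩ := floor_bound (Zfun V T) (∑ p ∈ stg E k, boltzmann T p) n (E k).length
        (G (k, n + 2 * (E k).length)) hZ0 (sum_le_Z V T hT hT1 _ (stg_subset hE k)) (by linarith)
        (hGb _ _).1 (hGb _ _).2
      refine ⟨e, ?_⟩
      rw [← bitsOf_floor _ hZ0, he]
      simp only [compOut, hxn]
  have hprefix : PrefixFree F.Dom := by
    intro p hp q hq hpq
    obtain ⟨x, hx⟩ := (hFd p).1 hp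
    obtain ⟨y, hy⟩ := (hFd q).1 hq
    obtain ⟨rfl, hx2, -⟩ := (compPred_iff _ _ _).1 hx
    obtain ⟨rfl, hy2, -⟩ := (compPred_iff _ _ _).1 hy
    rw [encP_prefix _ _ hx2 hy2 hpq]
  let f : Fin 3 → List Bool →. List Bool := fun e p => (F p).map fun y => bitsOf y.1 (y.2 + e)
  have hf : ∀ e, Partrec (f e) := by
    intro e
    refine Partrec.map hF (Primrec.to_comp ?_)
    exact primrec_bitsOf.comp (Primrec.fst.comp Primrec.snd)
      (Primrec.nat_add.comp (Primrec.snd.comp Primrec.snd) (Primrec.const _))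
  have hfdom : ∀ e p, p ∈ (f e).Dom ↔ p ∈ F.Dom := fun e p => Iff.rfl
  let C : Fin 3 → Computer := fun e => ⟨f e, hf e, by
    obtain ⟨p, -, y, hy, -⟩ := key 0
    exact ⟨p, (PFun.mem_dom F p).2 ⟨y, hy⟩⟩, hprefix⟩
  choose d hd using fun e => hU (C e)
  refine ⟨fun n => 4 * Real.sqrt n + (5 + ((∑ e, d e : ℕ) : ℝ)), g_tendsto _, fun n _ => ?_⟩
  obtain ⟨p, hp, y, hy, e, he⟩ := key n
  obtain ⟨q, hq, hql⟩ := hd e p ((PFun.mem_dom F p).2 ⟨y, hy⟩)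
  have hqm : firstBits (Zfun V T) n ∈ U.f q := by
    rw [hq, ← he]
    exact Part.mem_map (fun y : ℕ × ℕ => bitsOf y.1 (y.2 + e)) hy
  have h1 := complexity_le U _ q hqm
  have h2 : d e ≤ ∑ e, d e := Finset.single_le_sum (fun _ _ => Nat.zero_le _) (Finset.mem_univ e)
  have h3 : (complexity U (firstBits (Zfun V T) n) : ℝ) ≤ p.length + ((∑ e, d e : ℕ) : ℝ) := by
    exact_mod_cast h1.trans (hql.trans (by omega))
  linarith

/-- For optimal `V` and computable `T` with `0 < T ≤ 1`, the series
defining `Z_V(T)` converges and `Z_V(T)` is weakly Chaitin `T`-random and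
`T`-compressible. -/
theorem partitionFunction_partial_randomness
    (U : Computer) (hU : Optimal U) (V : Computer) (hV : Optimal V)
    (T : ℝ) (hT : 0 < T ∧ T ≤ 1) (hTcomp : ComputableReal T) :
    Summable (fun p : V.f.Dom => boltzmann T p.1) ∧
    WeaklyChaitinTRandom U T (Zfun V T) ∧ TCompressible U T (Zfun V T) := by
  exact ⟨summable_boltzmann V T hT.1 hT.2, weak_random U hU V hV T hT.1 hT.2 hTcomp,
    compressible U hU V T hT.1 hT.2 hTcomp⟩
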